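/- arXiv:1506.04282 — 2 statements merged into one kernel-verified Lean document; each statement's English description precedes it below -/
import Mathlib

section
/- Let γ ∈ (0, 1) and t > 0. Then the principal value integral ∫_ℝ ((t+h)₊^γ + (t−h)₊^γ − 2t^γ) / |h|^{1+2γ} dh equals 0, where a₊^γ := max(a,0)^γ. -/
noncomputable section TruncatedPower

open Real Set Filter Topology MeasureTheory

/-- The part of the second difference quotient of `x ↦ max x 0 ^ γ` at `1` which comes from the
left neighbours of `1`. -/
def leftDiffQuot (γ u : ℝ) : ℝ := (max (1 - u) 0 ^ γ - 1) / u ^ (1 + 2 * γ)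

/-- The symmetric second difference quotient of `x ↦ max x 0 ^ γ` at `1`. -/
def symmDiffQuot (γ h : ℝ) : ℝ :=
  (max (1 + h) 0 ^ γ + max (1 - h) 0 ^ γ - 2) / h ^ (1 + 2 * γ)

/-- A primitive of `symmDiffQuot γ` on the positive half-line. -/
def symmDiffPrimitive (γ x : ℝ) : ℝ :=
  ((1 + x) ^ γ - 1) ^ 2 / (2 * γ * x ^ (2 * γ)) + ∫ u in x / (1 + x)..x, leftDiffQuot γ u

variable {γ : ℝ}

lemma continuousOn_leftDiffQuot (h0 : 0 < γ) : ContinuousOn (leftDiffQuot γ) (Ioi 0) := by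
  have h1 : Continuous fun u : ℝ => max (1 - u) 0 ^ γ - 1 :=
    (((continuous_const.sub continuous_id).max continuous_const).rpow_const
      fun _ => Or.inr h0.le).sub continuous_const
  refine h1.continuousOn.div
    (continuousOn_id.rpow_const fun x hx => Or.inl (ne_of_gt hx)) fun x hx => ?_
  exact (rpow_pos_of_pos hx _).ne'

lemma intervalIntegrable_leftDiffQuot (h0 : 0 < γ) {a b : ℝ} (ha : 0 < a) (hb : 0 < b) :
    IntervalIntegrable (leftDiffQuot γ) volume a b :=
  ((continuousOn_leftDiffQuot h0).mono fun _ hx => (lt_min ha hb).trans_le hx.1).intervalIntegrable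

lemma hasDerivAt_integral_leftDiffQuot (h0 : 0 < γ) {x : ℝ} (hx : 0 < x) :
    HasDerivAt (fun y => ∫ u in (1 : ℝ)..y, leftDiffQuot γ u) (leftDiffQuot γ x) x :=
  intervalIntegral.integral_hasDerivAt_right (intervalIntegrable_leftDiffQuot h0 one_pos hx)
    ((continuousOn_leftDiffQuot h0).stronglyMeasurableAtFilter isOpen_Ioi x hx)
    ((continuousOn_leftDiffQuot h0).continuousAt (Ioi_mem_nhds hx))

lemma integral_leftDiffQuot_div_one_add (h0 : 0 < γ) {x : ℝ} (hx : 0 < x) :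
    ∫ u in x / (1 + x)..x, leftDiffQuot γ u =
      (∫ u in (1 : ℝ)..x, leftDiffQuot γ u) - ∫ u in (1 : ℝ)..x / (1 + x), leftDiffQuot γ u :=
  (intervalIntegral.integral_interval_sub_left (intervalIntegrable_leftDiffQuot h0 one_pos hx)
    (intervalIntegrable_leftDiffQuot h0 one_pos (by positivity))).symm

lemma hasDerivAt_div_one_add {x : ℝ} (hx : 0 < x) :
    HasDerivAt (fun y : ℝ => y / (1 + y)) (1 / (1 + x) ^ 2) x := by
  have h := (hasDerivAt_id x).div ((hasDerivAt_id x).const_add 1) (by simp; positivity)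
  refine h.congr_deriv ?_
  simp

lemma leftDiffQuot_div_one_add {x : ℝ} (hx : 0 < x) :
    leftDiffQuot γ (x / (1 + x)) * (1 / (1 + x) ^ 2) =
      (1 - (1 + x) ^ γ) * (1 + x) ^ γ / ((1 + x) * x ^ (1 + 2 * γ)) := by
  have h1 : 0 < 1 + x := by positivity
  have h2 : 1 - x / (1 + x) = (1 + x)⁻¹ := by field_simp; ring
  have h3 : (1 + x) ^ (1 + 2 * γ) = (1 + x) * ((1 + x) ^ γ) ^ 2 := by
    rw [rpow_add h1, rpow_one, mul_comm 2 γ, rpow_mul h1.le, rpow_two]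
  have h4 := rpow_pos_of_pos h1 γ
  have h5 := rpow_pos_of_pos hx (1 + 2 * γ)
  rw [leftDiffQuot, h2, max_eq_left (by positivity), inv_rpow h1.le, div_rpow hx.le h1.le, h3]
  field_simp

lemma hasDerivAt_symmDiffPrimitive (h0 : 0 < γ) {x : ℝ} (hx : 0 < x) :
    HasDerivAt (symmDiffPrimitive γ) (symmDiffQuot γ x) x := by
  have h1 : 0 < 1 + x := by positivity
  have hs := rpow_pos_of_pos h1 γ
  have hp := rpow_pos_of_pos hx (2 * γ)
  have hd : HasDerivAt (fun y : ℝ => (1 + y) ^ γ) (γ * ((1 + x) ^ γ / (1 + x))) x := by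
    have := ((hasDerivAt_id x).const_add 1).rpow_const (p := γ) (Or.inl h1.ne')
    rw [← rpow_sub_one h1.ne']
    simpa using this
  have he : HasDerivAt (fun y : ℝ => y ^ (2 * γ)) (2 * γ * (x ^ (2 * γ) / x)) x := by
    rw [← rpow_sub_one hx.ne']
    exact hasDerivAt_rpow_const (Or.inl hx.ne')
  have hA := ((hd.sub_const 1).pow 2).div (he.const_mul (2 * γ)) (by positivity)
  have hB := (hasDerivAt_integral_leftDiffQuot h0 hx).sub
    ((hasDerivAt_integral_leftDiffQuot h0 (show 0 < x / (1 + x) by positivity)).comp x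
      (hasDerivAt_div_one_add hx))
  have hE := (hA.add hB).congr_of_eventuallyEq (f₁ := symmDiffPrimitive γ) (by
    filter_upwards [Ioi_mem_nhds hx] with y hy
    simp only [symmDiffPrimitive, integral_leftDiffQuot_div_one_add h0 hy]
    rfl)
  refine hE.congr_deriv ?_
  rw [leftDiffQuot_div_one_add hx, symmDiffQuot, leftDiffQuot, max_eq_left h1.le,
    rpow_add hx, rpow_one]
  simp only [Pi.pow_apply]
  generalize max (1 - x) 0 ^ γ = m
  generalize (1 + x) ^ γ = s at *
  generalize x ^ (2 * γ) = p at *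
  field_simp
  ring

lemma abs_leftDiffQuot_le (h0 : 0 < γ) (h1 : γ < 1) {u : ℝ} (hu0 : 0 < u) (hu1 : u ≤ 1) :
    |leftDiffQuot γ u| ≤ u ^ (-(2 * γ)) := by
  have hb : 1 - u ≤ (1 - u) ^ γ := by
    simpa using rpow_le_rpow_of_exponent_ge' (sub_nonneg.2 hu1) (by linarith) h0.le h1.le
  have hc : (1 - u) ^ γ ≤ 1 := rpow_le_one (by linarith) (by linarith) h0.le
  have hp := rpow_pos_of_pos hu0 (2 * γ)
  rw [leftDiffQuot, max_eq_left (sub_nonneg.2 hu1), abs_div, abs_of_nonpos (by linarith),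
    abs_of_pos (rpow_pos_of_pos hu0 _), rpow_neg hu0.le, rpow_add hu0, rpow_one,
    div_le_iff₀ (by positivity)]
  field_simp
  linarith

lemma abs_symmDiffPrimitive_le (h0 : 0 < γ) (h1 : γ < 1) {x : ℝ} (hx0 : 0 < x) (hx1 : x ≤ 1) :
    |symmDiffPrimitive γ x| ≤ (1 / (2 * γ) + 2 ^ (2 * γ)) * x ^ (2 - 2 * γ) := by
  have hp := rpow_pos_of_pos hx0 (2 * γ)
  have hx2 : x ^ (2 - 2 * γ) = x ^ 2 / x ^ (2 * γ) := by rw [rpow_sub hx0, rpow_two]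
  have hA : |((1 + x) ^ γ - 1) ^ 2 / (2 * γ * x ^ (2 * γ))| ≤ 1 / (2 * γ) * x ^ (2 - 2 * γ) := by
    have ha : (1 + x) ^ γ ≤ 1 + γ * x :=
      rpow_one_add_le_one_add_mul_self (by linarith) h0.le h1.le
    have hb : 1 ≤ (1 + x) ^ γ := one_le_rpow (by linarith) h0.le
    have hc : ((1 + x) ^ γ - 1) ^ 2 ≤ x ^ 2 :=
      pow_le_pow_left₀ (by linarith) (by nlinarith) 2
    rw [abs_of_nonneg (by positivity), hx2]
    calc _ ≤ x ^ 2 / (2 * γ * x ^ (2 * γ)) := by gcongr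
      _ = _ := by field_simp
  have hy : x / 2 ≤ x / (1 + x) := by gcongr; linarith
  have hy' : x / (1 + x) ≤ x := div_le_self hx0.le (by linarith)
  have hB : |∫ u in x / (1 + x)..x, leftDiffQuot γ u| ≤ 2 ^ (2 * γ) * x ^ (2 - 2 * γ) := by
    have hC : ∀ u ∈ uIoc (x / (1 + x)) x, ‖leftDiffQuot γ u‖ ≤ (x / 2) ^ (-(2 * γ)) := by
      intro u hu
      rw [uIoc_of_le hy'] at hu
      have hu2 : x / 2 ≤ u := hy.trans hu.1.le
      refine (abs_leftDiffQuot_le h0 h1 (by linarith) (hu.2.trans hx1)).trans ?_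
      exact rpow_le_rpow_of_nonpos (by positivity) hu2 (by linarith)
    refine (intervalIntegral.norm_integral_le_of_norm_le_const hC).trans ?_
    have hl : |x - x / (1 + x)| ≤ x ^ 2 := by
      rw [abs_of_nonneg (by linarith)]
      have : x - x / (1 + x) = x ^ 2 / (1 + x) := by field_simp; ring
      rw [this]
      exact div_le_self (by positivity) (by linarith)
    calc _ ≤ (x / 2) ^ (-(2 * γ)) * x ^ 2 := by gcongr
      _ = _ := by
        rw [rpow_neg (by positivity), div_rpow hx0.le zero_le_two, hx2]
        field_simp
  rw [add_mul]
  exact (abs_add_le _ _).trans (add_le_add hA hB)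

lemma symmDiffPrimitive_zero : symmDiffPrimitive γ 0 = 0 := by
  simp [symmDiffPrimitive]

lemma continuousWithinAt_symmDiffPrimitive_zero (h0 : 0 < γ) (h1 : γ < 1) :
    ContinuousWithinAt (symmDiffPrimitive γ) (Ici 0) 0 := by
  rw [← continuousWithinAt_Ioi_iff_Ici, ContinuousWithinAt, symmDiffPrimitive_zero]
  have hr : Tendsto (fun x : ℝ => (1 / (2 * γ) + 2 ^ (2 * γ)) * x ^ (2 - 2 * γ)) (𝓝[>] 0)
      (𝓝 0) := by
    have hc : ContinuousAt (fun x : ℝ => x ^ (2 - 2 * γ)) 0 :=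
      continuousAt_rpow_const _ _ (Or.inr (by linarith))
    have := (hc.tendsto.mono_left (nhdsWithin_le_nhds (s := Ioi 0))).const_mul (1 / (2 * γ) + 2 ^ (2 * γ))
    rwa [zero_rpow (by linarith), mul_zero] at this
  refine squeeze_zero_norm' ?_ hr
  filter_upwards [Ioc_mem_nhdsGT one_pos] with x hx
  exact abs_symmDiffPrimitive_le h0 h1 hx.1 hx.2

lemma integral_leftDiffQuot_of_one_le (h0 : 0 < γ) {x : ℝ} (hx : 1 ≤ x) :
    ∫ u in (1 : ℝ)..x, leftDiffQuot γ u = (x ^ (-(2 * γ)) - 1) / (2 * γ) := by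
  have hc : ∫ u in (1 : ℝ)..x, leftDiffQuot γ u = ∫ u in (1 : ℝ)..x, -u ^ (-(1 + 2 * γ)) := by
    refine intervalIntegral.integral_congr fun u hu => ?_
    rw [uIcc_of_le hx] at hu
    have hu0 : 0 ≤ u := zero_le_one.trans hu.1
    simp only [leftDiffQuot]
    rw [max_eq_right (by linarith [hu.1]), zero_rpow h0.ne', rpow_neg hu0]
    ring
  rw [hc, intervalIntegral.integral_neg, integral_rpow (Or.inr ⟨by linarith, ?_⟩)]
  · rw [one_rpow, show -(1 + 2 * γ) + 1 = -(2 * γ) by ring]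
    field_simp
  · rw [uIcc_of_le hx]
    simp

lemma tendsto_symmDiffPrimitive_atTop (h0 : 0 < γ) :
    Tendsto (symmDiffPrimitive γ) atTop (𝓝 0) := by
  have hinv : Tendsto (fun x : ℝ => 1 + x⁻¹) atTop (𝓝 1) := by
    simpa using tendsto_inv_atTop_zero.const_add (1 : ℝ)
  have hA : Tendsto (fun x : ℝ => ((1 + x⁻¹) ^ γ - x ^ (-γ)) ^ 2 / (2 * γ)) atTop
      (𝓝 (1 / (2 * γ))) := by
    have h1 := hinv.rpow_const (p := γ) (Or.inr h0.le)
    simpa using ((h1.sub (tendsto_rpow_neg_atTop h0)).pow 2).div_const (2 * γ)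
  have hB : Tendsto (fun x : ℝ => (x ^ (-(2 * γ)) - 1) / (2 * γ)) atTop (𝓝 (-1 / (2 * γ))) := by
    simpa using ((tendsto_rpow_neg_atTop (show 0 < 2 * γ by positivity)).sub_const 1).div_const
      (2 * γ)
  have hC : Tendsto (fun x : ℝ => ∫ u in (1 : ℝ)..x / (1 + x), leftDiffQuot γ u) atTop (𝓝 0) := by
    have hq : Tendsto (fun x : ℝ => x / (1 + x)) atTop (𝓝 1) := by
      have := hinv.inv₀ one_ne_zero
      rw [inv_one] at this
      refine this.congr' ?_
      filter_upwards [eventually_gt_atTop 0] with x hx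
      field_simp
      ring
    have hc := (hasDerivAt_integral_leftDiffQuot h0 one_pos).continuousAt.tendsto.comp hq
    rwa [intervalIntegral.integral_same] at hc
  have hsum := (hA.add hB).sub hC
  rw [show 1 / (2 * γ) + -1 / (2 * γ) - 0 = 0 by ring] at hsum
  refine hsum.congr' ?_
  filter_upwards [eventually_ge_atTop 1] with x hx
  have hx0 : 0 < x := by linarith
  have hp := rpow_pos_of_pos hx0 γ
  rw [symmDiffPrimitive, integral_leftDiffQuot_div_one_add h0 hx0,
    integral_leftDiffQuot_of_one_le h0 hx, show 1 + x⁻¹ = (1 + x) / x by field_simp; ring,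
    div_rpow (by linarith) hx0.le, rpow_neg hx0.le γ, mul_comm 2 γ, rpow_mul hx0.le γ 2, rpow_two]
  field_simp
  ring

lemma symmDiffQuot_nonpos (h0 : 0 < γ) (h1 : γ < 1) {x : ℝ} (hx0 : 0 < x) (hx1 : x ≤ 1) :
    symmDiffQuot γ x ≤ 0 := by
  have ha : (1 + x) ^ γ ≤ 1 + γ * x :=
    rpow_one_add_le_one_add_mul_self (by linarith) h0.le h1.le
  have hb : (1 - x) ^ γ ≤ 1 + γ * -x :=
    rpow_one_add_le_one_add_mul_self (s := -x) (by linarith) h0.le h1.le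
  rw [symmDiffQuot, max_eq_left (by linarith), max_eq_left (by linarith)]
  exact div_nonpos_of_nonpos_of_nonneg (by linarith) (rpow_nonneg hx0.le _)

lemma abs_symmDiffQuot_le (h0 : 0 < γ) (h1 : γ < 1) {x : ℝ} (hx : 1 ≤ x) :
    |symmDiffQuot γ x| ≤ 2 * x ^ (-(1 + γ)) := by
  have hx0 : 0 < x := by linarith
  have ha : (1 + x) ^ γ ≤ 1 + x ^ γ := by
    simpa using rpow_add_le_add_rpow zero_le_one hx0.le h0.le h1.le
  have hb : 1 ≤ (1 + x) ^ γ := one_le_rpow (by linarith) h0.le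
  have hc : 1 ≤ x ^ γ := one_le_rpow hx h0.le
  have hn : |(1 + x) ^ γ - 2| ≤ 2 * x ^ γ := abs_le.2 ⟨by linarith, by linarith⟩
  rw [symmDiffQuot, max_eq_left (by linarith), max_eq_right (by linarith), zero_rpow h0.ne',
    add_zero, abs_div, abs_of_pos (rpow_pos_of_pos hx0 _), div_le_iff₀ (rpow_pos_of_pos hx0 _),
    mul_assoc, ← rpow_add hx0]
  ring_nf at hn ⊢
  exact hn

lemma measurable_symmDiffQuot : Measurable (symmDiffQuot γ) := by
  unfold symmDiffQuot
  fun_prop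

lemma integrableOn_symmDiffQuot (h0 : 0 < γ) (h1 : γ < 1) :
    IntegrableOn (symmDiffQuot γ) (Ioi 0) := by
  rw [← Ioc_union_Ioi_eq_Ioi zero_le_one]
  refine IntegrableOn.union ?_ ?_
  · have hcont : ContinuousOn (symmDiffPrimitive γ) (Icc 0 1) := by
      intro x hx
      rcases hx.1.eq_or_lt with rfl | hx0
      · exact (continuousWithinAt_symmDiffPrimitive_zero h0 h1).mono Icc_subset_Ici_self
      · exact (hasDerivAt_symmDiffPrimitive h0 hx0).continuousAt.continuousWithinAt
    refine integrable_neg_iff.1 (intervalIntegral.integrableOn_deriv_of_nonneg hcont.neg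
      (fun x hx => (hasDerivAt_symmDiffPrimitive h0 hx.1).neg) fun x hx => ?_)
    exact neg_nonneg.2 (symmDiffQuot_nonpos h0 h1 hx.1 hx.2.le)
  · refine Integrable.mono' ((integrableOn_Ioi_rpow_of_lt (a := -(1 + γ)) (by linarith)
      one_pos).const_mul 2) measurable_symmDiffQuot.aestronglyMeasurable ?_
    filter_upwards [ae_restrict_mem measurableSet_Ioi] with x hx
    exact abs_symmDiffQuot_le h0 h1 (le_of_lt hx)

lemma integral_Ioi_symmDiffQuot (h0 : 0 < γ) (h1 : γ < 1) :
    ∫ x in Ioi 0, symmDiffQuot γ x = 0 := by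
  rw [integral_Ioi_of_hasDerivAt_of_tendsto (continuousWithinAt_symmDiffPrimitive_zero h0 h1)
    (fun x hx => hasDerivAt_symmDiffPrimitive h0 hx) (integrableOn_symmDiffQuot h0 h1)
    (tendsto_symmDiffPrimitive_atTop h0), symmDiffPrimitive_zero, sub_zero]

lemma secondDifference_eq_symmDiffQuot {t : ℝ} (ht : 0 < t) (h : ℝ) :
    (max (t + h) 0 ^ γ + max (t - h) 0 ^ γ - 2 * t ^ γ) / |h| ^ (1 + 2 * γ) =
      t ^ γ / t ^ (1 + 2 * γ) * symmDiffQuot γ |t⁻¹ * h| := by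
  have hscale : ∀ a : ℝ, max (t + a) 0 ^ γ = t ^ γ * max (1 + t⁻¹ * a) 0 ^ γ := by
    intro a
    rw [← mul_rpow ht.le (le_max_right _ _), mul_max_of_nonneg _ _ ht.le, mul_zero, mul_add,
      mul_one, mul_inv_cancel_left₀ ht.ne']
  have heven : symmDiffQuot γ |t⁻¹ * h| =
      (max (1 + t⁻¹ * h) 0 ^ γ + max (1 - t⁻¹ * h) 0 ^ γ - 2) / |t⁻¹ * h| ^ (1 + 2 * γ) := by
    rw [symmDiffQuot]
    rcases abs_choice (t⁻¹ * h) with e | e <;> rw [e]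
    rw [sub_neg_eq_add, ← sub_eq_add_neg, add_comm (max (1 - t⁻¹ * h) 0 ^ γ)]
  have hpow : t ^ (1 + 2 * γ) * |t⁻¹ * h| ^ (1 + 2 * γ) = |h| ^ (1 + 2 * γ) := by
    rw [← mul_rpow ht.le (abs_nonneg _), abs_mul, abs_of_pos (inv_pos.2 ht),
      mul_inv_cancel_left₀ ht.ne']
  rw [heven, div_mul_div_comm, hpow, sub_eq_add_neg t h, hscale h, hscale (-h), mul_neg,
    ← sub_eq_add_neg]
  ring

end TruncatedPower

theorem stmt_11 (γ t : ℝ) (hγ : γ ∈ Set.Ioo (0:ℝ) 1) (ht : 0 < t) :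
    (∫ h : ℝ, (max (t + h) 0 ^ γ + max (t - h) 0 ^ γ - 2 * t ^ γ) /
      |h| ^ (1 + 2 * γ)) = 0 := by
  simp_rw [secondDifference_eq_symmDiffQuot ht]
  rw [MeasureTheory.integral_const_mul,
    MeasureTheory.Measure.integral_comp_mul_left (fun x => symmDiffQuot γ |x|), integral_comp_abs,
    integral_Ioi_symmDiffQuot hγ.1 hγ.2]
  simp
end

section
/- Let s ∈ (0, 1/2), set γ₀ := 1/2 + s, and let ε₀ ∈ (0, 1 − γ₀), γ := γ₀ + ε₀. Then there exists c⋆ > 0 (independent of ε₀) such that (1/2) ∫_ℝ ((1+t)₊^γ + (1−t)₊^γ − 2)/|t|^{2+2s} dt ≥ c⋆ ε₀, where the integral is taken in the principal value sense. -/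
open MeasureTheory Set Filter Topology

/-- The second difference `(1+t)^γ + (1-t)₊^γ - 2` is bounded by a multiple of `t²` near `0` and of
`t` at infinity. -/
lemma abs_rpow_second_difference_le {γ t : ℝ} (h0 : 0 < γ) (h1 : γ < 1) (ht : 0 < t) :
    |(1 + t) ^ γ + max (1 - t) 0 ^ γ - 2| ≤ if t ≤ 1 then 2 * t ^ 2 else 4 * t := by
  have hup : (1 + t) ^ γ ≤ 1 + γ * t :=
    rpow_one_add_le_one_add_mul_self (by linarith) h0.le h1.le
  split_ifs with h
  · rw [max_eq_left (by linarith)]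
    have hdown : (1 - t) ^ γ ≤ 1 - γ * t := by
      have := rpow_one_add_le_one_add_mul_self (s := -t) (by linarith) h0.le h1.le
      rw [← sub_eq_add_neg] at this
      linarith
    have hx : 0 ≤ (1 + t) ^ γ := by positivity
    have hy : 0 ≤ (1 - t) ^ γ := Real.rpow_nonneg (by linarith) _
    have hprod : 1 - t ^ 2 ≤ (1 + t) ^ γ * (1 - t) ^ γ := by
      rw [← Real.mul_rpow (by linarith) (by linarith)]
      have hfac : (1 + t) * (1 - t) = 1 - t ^ 2 := by ring
      rw [hfac]
      exact Real.self_le_rpow_of_le_one (by nlinarith) (by nlinarith) h1.le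
    rw [abs_le]
    constructor
    · by_contra! hc
      nlinarith [sq_nonneg ((1 + t) ^ γ - (1 - t) ^ γ), sq_nonneg t]
    · nlinarith [sq_nonneg t]
  · rw [max_eq_right (by linarith), Real.zero_rpow h0.ne']
    have hx : 0 ≤ (1 + t) ^ γ := by positivity
    push Not at h
    have : γ * t ≤ t := by nlinarith
    rw [abs_le]
    constructor <;> linarith

lemma continuousOn_rpow_Ioi_zero (r : ℝ) : ContinuousOn (fun t : ℝ => t ^ r) (Ioi 0) :=
  fun t ht => (Real.continuousAt_rpow_const t r (Or.inl (ne_of_gt ht))).continuousWithinAt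

lemma integrableOn_rpow_second_difference {γ k : ℝ} (h0 : 0 < γ) (h1 : γ < 1) (hk : 2 < k)
    (hk' : k < 3) :
    IntegrableOn (fun t : ℝ => ((1 + t) ^ γ + max (1 - t) 0 ^ γ - 2) * t ^ (-k)) (Ioi 0) := by
  have hcont : ContinuousOn
      (fun t : ℝ => ((1 + t) ^ γ + max (1 - t) 0 ^ γ - 2) * t ^ (-k)) (Ioi 0) := by
    refine ContinuousOn.mul (Continuous.continuousOn ?_) (continuousOn_rpow_Ioi_zero _)
    exact (((continuous_const.add continuous_id).rpow_const fun _ => Or.inr h0.le).add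
      (((continuous_const.sub continuous_id).max continuous_const).rpow_const
        fun _ => Or.inr h0.le)).sub continuous_const
  rw [← Ioc_union_Ioi_eq_Ioi zero_le_one, integrableOn_union]
  constructor
  · have hint : IntegrableOn (fun t : ℝ => 2 * t ^ (2 - k)) (Ioc 0 1) :=
      ((intervalIntegrable_iff_integrableOn_Ioc_of_le zero_le_one).1
        (intervalIntegral.intervalIntegrable_rpow' (by linarith))).const_mul 2
    refine hint.mono' ((hcont.mono Ioc_subset_Ioi_self).aestronglyMeasurable measurableSet_Ioc) ?_
    filter_upwards [ae_restrict_mem measurableSet_Ioc] with t ht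
    have hb := abs_rpow_second_difference_le h0 h1 ht.1
    rw [if_pos ht.2] at hb
    have hw : 0 < t ^ (-k) := Real.rpow_pos_of_pos ht.1 _
    rw [Real.norm_eq_abs, abs_mul, abs_of_pos hw, sub_eq_add_neg 2 k, Real.rpow_add ht.1,
      Real.rpow_two, ← mul_assoc]
    gcongr
  · have hint : IntegrableOn (fun t : ℝ => 4 * t ^ (1 - k)) (Ioi 1) :=
      (integrableOn_Ioi_rpow_of_lt (by linarith) one_pos).const_mul 4
    refine hint.mono' ((hcont.mono (Ioi_subset_Ioi zero_le_one)).aestronglyMeasurable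
      measurableSet_Ioi) ?_
    filter_upwards [ae_restrict_mem measurableSet_Ioi] with t ht
    have ht0 : 0 < t := one_pos.trans ht
    have hb := abs_rpow_second_difference_le h0 h1 ht0
    rw [if_neg (not_le.2 ht)] at hb
    have hw : 0 < t ^ (-k) := Real.rpow_pos_of_pos ht0 _
    rw [Real.norm_eq_abs, abs_mul, abs_of_pos hw, sub_eq_add_neg 1 k, Real.rpow_add ht0,
      Real.rpow_one, ← mul_assoc]
    gcongr

lemma integrableOn_one_add_rpow_sub_one {a δ : ℝ} (ha : 1 / 2 < a) (ha1 : a < 1) (hδ : 0 < δ) :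
    IntegrableOn (fun t : ℝ => ((1 + t) ^ a - 1) * t ^ (-(1 + 2 * a))) (Ioi δ) := by
  have hint : IntegrableOn (fun t : ℝ => t ^ (-(2 * a))) (Ioi δ) :=
    integrableOn_Ioi_rpow_of_lt (by linarith) hδ
  refine hint.mono' (ContinuousOn.aestronglyMeasurable ?_ measurableSet_Ioi) ?_
  · refine ContinuousOn.mul (Continuous.continuousOn ?_)
      ((continuousOn_rpow_Ioi_zero _).mono (Ioi_subset_Ioi hδ.le))
    exact ((continuous_const.add continuous_id).rpow_const fun _ => Or.inr (by linarith)).sub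
      continuous_const
  · filter_upwards [ae_restrict_mem measurableSet_Ioi] with t ht
    have ht0 : 0 < t := hδ.trans ht
    have hup : (1 + t) ^ a ≤ 1 + a * t :=
      rpow_one_add_le_one_add_mul_self (by linarith) (by linarith) ha1.le
    have hlow : 1 ≤ (1 + t) ^ a := Real.one_le_rpow (by linarith) (by linarith)
    have hw : 0 < t ^ (-(1 + 2 * a)) := Real.rpow_pos_of_pos ht0 _
    have hsplit : t ^ (-(2 * a)) = t * t ^ (-(1 + 2 * a)) := by
      rw [← Real.rpow_one_add' ht0.le (by linarith)]
      congr 1; ring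
    rw [Real.norm_eq_abs, abs_of_nonneg (mul_nonneg (by linarith) hw.le), hsplit]
    gcongr
    nlinarith

lemma integrableOn_max_one_sub_rpow_sub_one {a δ : ℝ} (ha : 0 < a) (hδ : 0 < δ) :
    IntegrableOn (fun t : ℝ => (max (1 - t) 0 ^ a - 1) * t ^ (-(1 + 2 * a))) (Ioi δ) := by
  have hint : IntegrableOn (fun t : ℝ => t ^ (-(1 + 2 * a))) (Ioi δ) :=
    integrableOn_Ioi_rpow_of_lt (by linarith) hδ
  refine hint.mono' (ContinuousOn.aestronglyMeasurable ?_ measurableSet_Ioi) ?_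
  · refine ContinuousOn.mul (Continuous.continuousOn ?_)
      ((continuousOn_rpow_Ioi_zero _).mono (Ioi_subset_Ioi hδ.le))
    exact (((continuous_const.sub continuous_id).max continuous_const).rpow_const
      fun _ => Or.inr ha.le).sub continuous_const
  · filter_upwards [ae_restrict_mem measurableSet_Ioi] with t ht
    have ht0 : 0 < t := hδ.trans ht
    have hw : 0 < t ^ (-(1 + 2 * a)) := Real.rpow_pos_of_pos ht0 _
    have h0 : 0 ≤ max (1 - t) 0 ^ a := Real.rpow_nonneg (le_max_right _ _) _
    have h1 : max (1 - t) 0 ^ a ≤ 1 :=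
      Real.rpow_le_one (le_max_right _ _) (max_le (by linarith) zero_le_one) ha.le
    rw [Real.norm_eq_abs, abs_mul, abs_of_pos hw]
    refine mul_le_of_le_one_left hw.le ?_
    rw [abs_le]
    constructor <;> linarith

/-- The inversion `t = τ / (1 - τ)` moves the integral of `((1+t)^a - 1) t^{-1-2a}` to the unit
interval. -/
lemma integral_inversion_le {a δ : ℝ} (ha : 1 / 2 < a) (ha1 : a < 1) (hδ : 0 < δ) :
    IntegrableOn (fun τ : ℝ => ((1 - τ) ^ (a - 1) - (1 - τ) ^ (2 * a - 1)) * τ ^ (-(1 + 2 * a)))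
      (Ioo δ 1) ∧
    ∫ τ in Ioo δ 1, ((1 - τ) ^ (a - 1) - (1 - τ) ^ (2 * a - 1)) * τ ^ (-(1 + 2 * a)) ≤
      ∫ t in Ioi δ, ((1 + t) ^ a - 1) * t ^ (-(1 + 2 * a)) := by
  set g : ℝ → ℝ := fun t => ((1 + t) ^ a - 1) * t ^ (-(1 + 2 * a)) with hg
  have hgint : IntegrableOn g (Ioi δ) := integrableOn_one_add_rpow_sub_one ha ha1 hδ
  set f : ℝ → ℝ := fun τ => τ / (1 - τ) with hf
  set f' : ℝ → ℝ := fun τ => ((1 - τ) ^ 2)⁻¹ with hf'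
  have hderiv : ∀ τ ∈ Ioo δ 1, HasDerivWithinAt f (f' τ) (Ioo δ 1) τ := by
    intro τ hτ
    have hne : 1 - τ ≠ 0 := by linarith [hτ.2]
    have := ((hasDerivAt_id τ).div ((hasDerivAt_id τ).const_sub 1) hne).hasDerivWithinAt
      (s := Ioo δ 1)
    refine this.congr_deriv ?_
    simp only [hf', id]
    field_simp
    ring
  have hinj : InjOn f (Ioo δ 1) := by
    intro x hx y hy hxy
    have hx' : 1 - x ≠ 0 := by linarith [hx.2]
    have hy' : 1 - y ≠ 0 := by linarith [hy.2]
    simp only [hf] at hxy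
    rw [div_eq_div_iff hx' hy'] at hxy
    linarith
  have himage : f '' Ioo δ 1 ⊆ Ioi δ := by
    rintro _ ⟨τ, hτ, rfl⟩
    have hpos : 0 < 1 - τ := by linarith [hτ.2]
    simp only [hf, mem_Ioi]
    rw [lt_div_iff₀ hpos]
    nlinarith [hτ.1, hτ.2]
  have heq : EqOn (fun τ => |f' τ| • g (f τ))
      (fun τ => ((1 - τ) ^ (a - 1) - (1 - τ) ^ (2 * a - 1)) * τ ^ (-(1 + 2 * a))) (Ioo δ 1) := by
    intro τ hτ
    have hτ0 : 0 < τ := hδ.trans hτ.1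
    have hv : 0 < 1 - τ := by linarith [hτ.2]
    have hone : 1 + f τ = (1 - τ)⁻¹ := by
      simp only [hf]
      field_simp
      ring
    have hpow : |f' τ| = (1 - τ) ^ (-2 : ℝ) := by
      rw [abs_of_pos (by positivity), Real.rpow_neg hv.le, Real.rpow_two]
    simp only [smul_eq_mul, hg]
    rw [hone, hpow, Real.inv_rpow hv.le, ← Real.rpow_neg hv.le]
    simp only [hf]
    rw [Real.div_rpow hτ0.le hv.le, Real.rpow_neg hv.le (1 + 2 * a), div_inv_eq_mul]
    have e1 : (1 - τ) ^ (a - 1) = (1 - τ) ^ (-2 : ℝ) * (1 - τ) ^ (-a) * (1 - τ) ^ (1 + 2 * a) := by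
      rw [← Real.rpow_add hv, ← Real.rpow_add hv]
      congr 1; ring
    have e2 : (1 - τ) ^ (2 * a - 1) = (1 - τ) ^ (-2 : ℝ) * (1 - τ) ^ (1 + 2 * a) := by
      rw [← Real.rpow_add hv]
      congr 1; ring
    rw [e1, e2]
    ring
  constructor
  · refine IntegrableOn.congr_fun ?_ heq measurableSet_Ioo
    exact (integrableOn_image_iff_integrableOn_abs_deriv_smul measurableSet_Ioo hderiv hinj g).1
      (hgint.mono_set himage)
  · rw [← setIntegral_congr_fun measurableSet_Ioo heq,
      ← integral_image_eq_integral_abs_deriv_smul measurableSet_Ioo hderiv hinj g]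
    refine setIntegral_mono_set hgint ?_ himage.eventuallyLE
    filter_upwards [ae_restrict_mem measurableSet_Ioi] with t ht
    have ht0 : 0 < t := hδ.trans ht
    have hlow : 1 ≤ (1 + t) ^ a := Real.one_le_rpow (by linarith) (by linarith)
    exact mul_nonneg (by linarith) (Real.rpow_nonneg ht0.le _)

lemma hasDerivAt_one_sub_rpow_sq_mul {a τ : ℝ} (ha : 0 < a) (h0 : 0 < τ) (h1 : τ < 1) :
    HasDerivAt (fun x : ℝ => 1 / (2 * a) * ((1 - (1 - x) ^ a) ^ 2 * x ^ (-(2 * a))))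
      (((1 - τ) ^ (a - 1) - (1 - τ) ^ (2 * a - 1)) * τ ^ (-(1 + 2 * a)) +
        ((1 - τ) ^ a - 1) * τ ^ (-(1 + 2 * a))) τ := by
  have hv : 0 < 1 - τ := by linarith
  have hd1 : HasDerivAt (fun x : ℝ => (1 - x) ^ a) (-1 * a * (1 - τ) ^ (a - 1)) τ :=
    ((hasDerivAt_id τ).const_sub 1).rpow_const (Or.inl hv.ne')
  have hd2 : HasDerivAt (fun x : ℝ => x ^ (-(2 * a))) (-(2 * a) * τ ^ (-(2 * a) - 1)) τ :=
    Real.hasDerivAt_rpow_const (Or.inl h0.ne')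
  refine ((((hd1.const_sub 1).pow 2).mul hd2).const_mul (1 / (2 * a))).congr_deriv ?_
  have e1 : (1 - τ) ^ a = (1 - τ) ^ (a - 1) * (1 - τ) := by
    rw [← Real.rpow_add_one hv.ne']
    congr 1; ring
  have e2 : (1 - τ) ^ (2 * a - 1) = (1 - τ) ^ (a - 1) * ((1 - τ) ^ (a - 1) * (1 - τ)) := by
    rw [← e1, ← Real.rpow_add hv]
    congr 1; ring
  have e3 : τ ^ (-(2 * a)) = τ ^ (-(1 + 2 * a)) * τ := by
    rw [← Real.rpow_add_one h0.ne']
    congr 1; ring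
  have e4 : τ ^ (-(2 * a) - 1) = τ ^ (-(1 + 2 * a)) := by
    congr 1; ring
  simp only [Pi.pow_apply]
  rw [e4, e3, e2, e1]
  generalize (1 - τ) ^ (a - 1) = u
  generalize τ ^ (-(1 + 2 * a)) = w
  field_simp
  ring

/-- Truncated form of the `a`-harmonicity of `t₊^a` at `1`. -/
lemma neg_le_integral_rpow_second_difference {a δ : ℝ} (ha : 1 / 2 < a) (ha1 : a < 1)
    (hδ : 0 < δ) (hδ1 : δ < 1) :
    -(1 / (2 * a) * δ ^ (2 - 2 * a)) ≤
      ∫ t in Ioi δ, ((1 + t) ^ a + max (1 - t) 0 ^ a - 2) * t ^ (-(1 + 2 * a)) := by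
  have ha0 : 0 < a := by linarith
  obtain ⟨hint1, hle⟩ := integral_inversion_le ha ha1 hδ
  have hint2 := integrableOn_max_one_sub_rpow_sub_one ha0 hδ
  have hsplit : ∫ t in Ioi δ, ((1 + t) ^ a + max (1 - t) 0 ^ a - 2) * t ^ (-(1 + 2 * a)) =
      (∫ t in Ioi δ, ((1 + t) ^ a - 1) * t ^ (-(1 + 2 * a))) +
        ∫ t in Ioi δ, (max (1 - t) 0 ^ a - 1) * t ^ (-(1 + 2 * a)) := by
    rw [← integral_add (integrableOn_one_add_rpow_sub_one ha ha1 hδ) hint2]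
    congr 1
    ext t
    ring
  have heq : EqOn (fun t : ℝ => (max (1 - t) 0 ^ a - 1) * t ^ (-(1 + 2 * a)))
      (fun t : ℝ => ((1 - t) ^ a - 1) * t ^ (-(1 + 2 * a))) (Ioo δ 1) := by
    intro t ht
    simp only
    rw [max_eq_left (by linarith [ht.2])]
  have hint3 : IntegrableOn (fun t : ℝ => ((1 - t) ^ a - 1) * t ^ (-(1 + 2 * a))) (Ioo δ 1) :=
    (hint2.mono_set Ioo_subset_Ioi_self).congr_fun heq measurableSet_Ioo
  have htail : ∫ t in Ioi (1 : ℝ), (max (1 - t) 0 ^ a - 1) * t ^ (-(1 + 2 * a)) =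
      -(1 / (2 * a)) := by
    have : EqOn (fun t : ℝ => (max (1 - t) 0 ^ a - 1) * t ^ (-(1 + 2 * a)))
        (fun t : ℝ => -t ^ (-(1 + 2 * a))) (Ioi 1) := by
      intro t ht
      simp only
      rw [max_eq_right (by linarith [mem_Ioi.1 ht]), Real.zero_rpow ha0.ne']
      ring
    rw [setIntegral_congr_fun measurableSet_Ioi this, integral_neg,
      integral_Ioi_rpow_of_lt (by linarith) one_pos, Real.one_rpow]
    have : -(1 + 2 * a) + 1 = -(2 * a) := by ring
    rw [this, neg_div_neg_eq]
  have hhead : ∫ t in Ioi δ, (max (1 - t) 0 ^ a - 1) * t ^ (-(1 + 2 * a)) =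
      (∫ t in Ioo δ 1, ((1 - t) ^ a - 1) * t ^ (-(1 + 2 * a))) - 1 / (2 * a) := by
    rw [← Ioc_union_Ioi_eq_Ioi hδ1.le, setIntegral_union (Ioc_disjoint_Ioi le_rfl)
      measurableSet_Ioi (hint2.mono_set Ioc_subset_Ioi_self)
      (hint2.mono_set (Ioi_subset_Ioi hδ1.le)), htail, integral_Ioc_eq_integral_Ioo,
      setIntegral_congr_fun measurableSet_Ioo heq]
    ring
  have hftc : (∫ t in Ioo δ 1,
        ((1 - t) ^ (a - 1) - (1 - t) ^ (2 * a - 1)) * t ^ (-(1 + 2 * a))) +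
      (∫ t in Ioo δ 1, ((1 - t) ^ a - 1) * t ^ (-(1 + 2 * a))) =
      1 / (2 * a) - 1 / (2 * a) * ((1 - (1 - δ) ^ a) ^ 2 * δ ^ (-(2 * a))) := by
    rw [← integral_add hint1 hint3, ← integral_Ioc_eq_integral_Ioo,
      ← intervalIntegral.integral_of_le hδ1.le,
      intervalIntegral.integral_eq_sub_of_hasDerivAt_of_le
        (f := fun x : ℝ => 1 / (2 * a) * ((1 - (1 - x) ^ a) ^ 2 * x ^ (-(2 * a)))) hδ1.le]
    · simp [Real.zero_rpow ha0.ne']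
    · refine ContinuousOn.mul continuousOn_const (ContinuousOn.mul (Continuous.continuousOn ?_)
        ((continuousOn_rpow_Ioi_zero _).mono fun x hx => hδ.trans_le hx.1))
      exact (continuous_const.sub ((continuous_const.sub continuous_id).rpow_const
        fun _ => Or.inr ha0.le)).pow 2
    · exact fun x hx => hasDerivAt_one_sub_rpow_sq_mul ha0 (hδ.trans hx.1) hx.2
    · rw [intervalIntegrable_iff_integrableOn_Ioo_of_le hδ1.le]
      exact hint1.add hint3
  have hbound : (1 - (1 - δ) ^ a) ^ 2 * δ ^ (-(2 * a)) ≤ δ ^ (2 - 2 * a) := by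
    have hlow : 1 - δ ≤ (1 - δ) ^ a :=
      Real.self_le_rpow_of_le_one (by linarith) (by linarith) ha1.le
    have hup : (1 - δ) ^ a ≤ 1 := Real.rpow_le_one (by linarith) (by linarith) ha0.le
    rw [sub_eq_add_neg 2 (2 * a), Real.rpow_add hδ, Real.rpow_two]
    gcongr
    linarith
  have hc : 0 < 1 / (2 * a) := by positivity
  have := mul_le_mul_of_nonneg_left hbound hc.le
  rw [hsplit, hhead]
  linarith

lemma rpow_second_difference_ge {a ε t : ℝ} (ha : 0 < a) (hε : 0 < ε) (ht : 0 < t) :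
    (1 + ε / a) * ((1 + t) ^ a + max (1 - t) 0 ^ a - 2) + (Ioi (1 : ℝ)).indicator 1 t * (ε / a) ≤
      (1 + t) ^ (a + ε) + max (1 - t) 0 ^ (a + ε) - 2 := by
  have hp : 1 ≤ 1 + ε / a := by linarith [div_pos hε ha]
  have hbern : ∀ u : ℝ, 0 ≤ u → 1 + (1 + ε / a) * (u ^ a - 1) ≤ u ^ (a + ε) := by
    intro u hu
    have h := one_add_mul_self_le_rpow_one_add (s := u ^ a - 1)
      (by linarith [Real.rpow_nonneg hu a]) hp
    rw [add_sub_cancel, ← Real.rpow_mul hu] at h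
    have : a * (1 + ε / a) = a + ε := by field_simp
    rwa [this] at h
  have h1 := hbern (1 + t) (by linarith)
  by_cases h : 1 < t
  · rw [indicator_of_mem (mem_Ioi.2 h), max_eq_right (by linarith), Real.zero_rpow ha.ne',
      Real.zero_rpow (by linarith), Pi.one_apply]
    linarith
  · rw [indicator_of_notMem (by simpa using h)]
    linarith [hbern (max (1 - t) 0) (le_max_right _ _)]

lemma integral_rpow_second_difference_ge {a ε : ℝ} (ha : 1 / 2 < a) (hε : 0 < ε)
    (haε : a + ε < 1) :
    ε / a * (1 / (2 * a)) ≤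
      ∫ t in Ioi (0 : ℝ), ((1 + t) ^ (a + ε) + max (1 - t) 0 ^ (a + ε) - 2) *
        t ^ (-(1 + 2 * a)) := by
  have ha0 : 0 < a := by linarith
  have ha1 : a < 1 := by linarith
  have hintγ := integrableOn_rpow_second_difference (γ := a + ε) (k := 1 + 2 * a) (by linarith)
    haε (by linarith) (by linarith)
  have hinta := integrableOn_rpow_second_difference (γ := a) (k := 1 + 2 * a) ha0 ha1
    (by linarith) (by linarith)
  have hlim : Tendsto (fun δ : ℝ => ∫ t in Ioi δ,
      ((1 + t) ^ (a + ε) + max (1 - t) 0 ^ (a + ε) - 2) * t ^ (-(1 + 2 * a))) (𝓝[>] 0)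
      (𝓝 (∫ t in Ioi (0 : ℝ),
        ((1 + t) ^ (a + ε) + max (1 - t) 0 ^ (a + ε) - 2) * t ^ (-(1 + 2 * a)))) := by
    have hcover : AECover (volume.restrict (Ioi (0 : ℝ))) (𝓝[>] (0 : ℝ)) fun δ => Ioi δ :=
      aecover_Ioi_of_Ioi (tendsto_id.mono_left nhdsWithin_le_nhds)
    refine (hcover.integral_tendsto_of_countably_generated hintγ).congr' ?_
    filter_upwards [self_mem_nhdsWithin] with δ hδ
    rw [Measure.restrict_restrict measurableSet_Ioi,
      inter_eq_left.2 (Ioi_subset_Ioi (le_of_lt hδ))]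
  have hlow : Tendsto (fun δ : ℝ => (1 + ε / a) * -(1 / (2 * a) * δ ^ (2 - 2 * a)) +
      ε / a * (1 / (2 * a))) (𝓝[>] 0) (𝓝 (ε / a * (1 / (2 * a)))) := by
    have h : Continuous (fun δ : ℝ => (1 + ε / a) * -(1 / (2 * a) * δ ^ (2 - 2 * a)) +
        ε / a * (1 / (2 * a))) :=
      (continuous_const.mul (continuous_const.mul (continuous_id.rpow_const
        fun _ => Or.inr (by linarith))).neg).add continuous_const
    have h0 := (h.tendsto 0).mono_left (nhdsWithin_le_nhds (s := Ioi 0))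
    rwa [Real.zero_rpow (by linarith), mul_zero, neg_zero, mul_zero, zero_add] at h0
  refine le_of_tendsto_of_tendsto hlow hlim ?_
  filter_upwards [Ioo_mem_nhdsGT one_pos] with δ hδ
  have hsub : Ioi δ ⊆ Ioi 0 := Ioi_subset_Ioi hδ.1.le
  have htail : IntegrableOn ((Ioi (1 : ℝ)).indicator fun t : ℝ => t ^ (-(1 + 2 * a))) (Ioi δ) :=
    (integrableOn_Ioi_rpow_of_lt (by linarith) hδ.1).indicator measurableSet_Ioi
  have htail_eq : ∫ t in Ioi δ, (Ioi (1 : ℝ)).indicator (fun t : ℝ => t ^ (-(1 + 2 * a))) t =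
      1 / (2 * a) := by
    rw [setIntegral_indicator measurableSet_Ioi, inter_eq_right.2 (Ioi_subset_Ioi hδ.2.le),
      integral_Ioi_rpow_of_lt (by linarith) one_pos, Real.one_rpow]
    have : -(1 + 2 * a) + 1 = -(2 * a) := by ring
    rw [this, neg_div_neg_eq]
  calc (1 + ε / a) * -(1 / (2 * a) * δ ^ (2 - 2 * a)) + ε / a * (1 / (2 * a))
      ≤ (1 + ε / a) * (∫ t in Ioi δ,
          ((1 + t) ^ a + max (1 - t) 0 ^ a - 2) * t ^ (-(1 + 2 * a))) +
        ε / a * ∫ t in Ioi δ, (Ioi (1 : ℝ)).indicator (fun t : ℝ => t ^ (-(1 + 2 * a))) t := by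
        rw [htail_eq]
        gcongr
        exact neg_le_integral_rpow_second_difference ha ha1 hδ.1 hδ.2
    _ = ∫ t in Ioi δ, ((1 + ε / a) *
          (((1 + t) ^ a + max (1 - t) 0 ^ a - 2) * t ^ (-(1 + 2 * a))) +
        ε / a * (Ioi (1 : ℝ)).indicator (fun t : ℝ => t ^ (-(1 + 2 * a))) t) := by
        rw [integral_add ((hinta.mono_set hsub).const_mul _) (htail.const_mul _),
          integral_const_mul, integral_const_mul]
    _ ≤ _ := by
        refine setIntegral_mono_on (((hinta.mono_set hsub).const_mul _).add (htail.const_mul _))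
          (hintγ.mono_set hsub) measurableSet_Ioi fun t ht => ?_
        have ht0 : 0 < t := hδ.1.trans ht
        have h := mul_le_mul_of_nonneg_right (rpow_second_difference_ge ha0 hε ht0)
          (Real.rpow_nonneg ht0.le (-(1 + 2 * a)))
        refine le_trans (le_of_eq ?_) h
        by_cases h1 : t ∈ Ioi (1 : ℝ)
        · rw [indicator_of_mem h1, indicator_of_mem h1, Pi.one_apply]
          ring
        · rw [indicator_of_notMem h1, indicator_of_notMem h1]
          ring

theorem stmt_12 (s : ℝ) (hs : s ∈ Set.Ioo (0:ℝ) (1/2)) :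
    ∃ c : ℝ, 0 < c ∧ ∀ ε₀ : ℝ, ε₀ ∈ Set.Ioo 0 (1 - (1/2 + s)) →
      c * ε₀ ≤ (1/2) * ∫ t : ℝ,
        (max (1 + t) 0 ^ (1/2 + s + ε₀) + max (1 - t) 0 ^ (1/2 + s + ε₀) - 2) /
          |t| ^ (2 + 2 * s) := by
  obtain ⟨hs0, hs1⟩ := hs
  refine ⟨1 / (1 / 2 + s) * (1 / (2 * (1 / 2 + s))), by positivity, fun ε hε => ?_⟩
  obtain ⟨hε0, hε1⟩ := hε
  have hmain := integral_rpow_second_difference_ge (a := 1 / 2 + s) (ε := ε) (by linarith) hε0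
    (by linarith)
  have heven : ∀ t : ℝ,
      (max (1 + t) 0 ^ (1 / 2 + s + ε) + max (1 - t) 0 ^ (1 / 2 + s + ε) - 2) /
        |t| ^ (2 + 2 * s) =
      (fun x : ℝ => (max (1 + x) 0 ^ (1 / 2 + s + ε) + max (1 - x) 0 ^ (1 / 2 + s + ε) - 2) /
        x ^ (2 + 2 * s)) |t| := by
    intro t
    rcases abs_cases t with ⟨h, _⟩ | ⟨h, _⟩
    · simp only [h]
    · simp only [h, sub_neg_eq_add, ← sub_eq_add_neg]
      rw [add_comm (max (1 + t) 0 ^ (1 / 2 + s + ε))]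
  rw [(integral_congr_ae (ae_of_all _ heven)).trans
    (integral_comp_abs (f := fun x : ℝ =>
      (max (1 + x) 0 ^ (1 / 2 + s + ε) + max (1 - x) 0 ^ (1 / 2 + s + ε) - 2) /
        x ^ (2 + 2 * s)))]
  have hpos : EqOn
      (fun x : ℝ => (max (1 + x) 0 ^ (1 / 2 + s + ε) + max (1 - x) 0 ^ (1 / 2 + s + ε) - 2) /
        x ^ (2 + 2 * s))
      (fun x : ℝ => ((1 + x) ^ (1 / 2 + s + ε) + max (1 - x) 0 ^ (1 / 2 + s + ε) - 2) *
        x ^ (-(1 + 2 * (1 / 2 + s)))) (Ioi 0) := by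
    intro x hx
    have hx0 : 0 < x := hx
    have hk : 1 + 2 * (1 / 2 + s) = 2 + 2 * s := by ring
    simp only
    rw [max_eq_left (by linarith), hk, Real.rpow_neg hx0.le, div_eq_mul_inv]
  rw [setIntegral_congr_fun measurableSet_Ioi hpos]
  have : 1 / (1 / 2 + s) * (1 / (2 * (1 / 2 + s))) * ε =
      ε / (1 / 2 + s) * (1 / (2 * (1 / 2 + s))) := by ring
  linarith
end
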